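/- arXiv:1905.11326 — 4 statements merged into one kernel-verified Lean document; each statement's English description precedes it below -/
import Mathlib

section
/- Let σ be a generator of Gal(F_{q^m}/F_q) and let C ⊆ F_{q^m}^n be an F_{q^m}-linear code. If s_i^σ(C) = s_{i+1}^σ(C) for some i ≥ 0, then s_{i+j}^σ(C) = s_i^σ(C) for all j ≥ 0. -/
open Module

section RankMetricDefs

variable {F K : Type} [Field F] [Field K] [Algebra F K]

/-- Entrywise application of a ring automorphism of `K` to vectors in `K^n`,
as a semilinear map. -/
def entrywiseMap (n : ℕ) (σ : K ≃+* K) :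
    (Fin n → K) →ₛₗ[(σ : K →+* K)] (Fin n → K) where
  toFun v := fun j => σ (v j)
  map_add' u v := by funext j; simp
  map_smul' c v := by funext j; simp [smul_eq_mul]

instance (σ : K ≃+* K) : RingHomSurjective ((σ : K →+* K)) := ⟨σ.surjective⟩

/-- The image `σ(C)` of a code `C ⊆ K^n` under entrywise application of a
ring automorphism `σ` of `K`. -/
def codeMap {n : ℕ} (σ : K ≃+* K) (C : Submodule K (Fin n → K)) :
    Submodule K (Fin n → K) :=
  Submodule.map (entrywiseMap n σ) C

/-- `S_i^σ(C) = C + σ(C) + … + σ^i(C)`. -/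
def Sseq {n : ℕ} (σ : K ≃ₐ[F] K) (C : Submodule K (Fin n → K)) (i : ℕ) :
    Submodule K (Fin n → K) :=
  (Finset.range (i + 1)).sup fun j => codeMap ((σ ^ j : K ≃ₐ[F] K) : K ≃+* K) C

/-- `s_i^σ(C) = dim_K S_i^σ(C)`. -/
noncomputable def sseq {n : ℕ} (σ : K ≃ₐ[F] K) (C : Submodule K (Fin n → K)) (i : ℕ) : ℕ :=
  Module.finrank K (Sseq σ C i)

/-- Semilinear equivalence of rank-metric codes: `C' = θ(C)·A` for a field
automorphism `θ` of `K` and an invertible matrix `A` with entries in (the image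
of) `F`. -/
def SemilinEquiv (F : Type) [Field F] {K : Type} [Field K] [Algebra F K] {n : ℕ}
    (C C' : Submodule K (Fin n → K)) : Prop :=
  ∃ (θ : K ≃+* K) (A : Matrix (Fin n) (Fin n) K),
    (∀ i j, A i j ∈ Set.range (algebraMap F K)) ∧ IsUnit A ∧
    (C' : Set (Fin n → K)) =
      (fun v => Matrix.vecMul (fun j => θ (v j)) A) '' (C : Set (Fin n → K))

/-- The Gabidulin code `G_k^σ(α) = ⟨α, σ(α), …, σ^{k-1}(α)⟩_K`. -/
def Gab {n : ℕ} (σ : K ≃ₐ[F] K) (k : ℕ) (α : Fin n → K) : Submodule K (Fin n → K) :=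
  Submodule.span K {v | ∃ j < k, v = fun x => (σ ^ j) (α x)}

/-- Sheekey's twisted Gabidulin code
`H_{k,η}^σ(α) = ⟨α + η·σ^k(α), σ(α), …, σ^{k-1}(α)⟩_K`. -/
def TGab {n : ℕ} (σ : K ≃ₐ[F] K) (k : ℕ) (η : K) (α : Fin n → K) :
    Submodule K (Fin n → K) :=
  Submodule.span K
    (insert (fun x => α x + η * (σ ^ k) (α x))
      {v | ∃ j, 1 ≤ j ∧ j < k ∧ v = fun x => (σ ^ j) (α x)})

end RankMetricDefs

section StationarySums

variable {F K : Type} [Field F] [Field K] [Algebra F K] {n : ℕ}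

theorem codeMap_mono (σ : K ≃+* K) {C D : Submodule K (Fin n → K)} (h : C ≤ D) :
    codeMap σ C ≤ codeMap σ D :=
  Submodule.map_mono h

theorem codeMap_codeMap_pow (σ : K ≃ₐ[F] K) (C : Submodule K (Fin n → K)) (j : ℕ) :
    codeMap (σ : K ≃+* K) (codeMap ((σ ^ j : K ≃ₐ[F] K) : K ≃+* K) C) =
      codeMap ((σ ^ (j + 1) : K ≃ₐ[F] K) : K ≃+* K) C := by
  ext v
  simp only [codeMap, Submodule.mem_map, exists_exists_and_eq_and]
  refine exists_congr fun u => and_congr_right fun _ => Eq.congr_left ?_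
  funext x
  change σ ((σ ^ j) (u x)) = (σ ^ (j + 1)) (u x)
  rw [pow_succ', AlgEquiv.mul_apply]

theorem Sseq_succ (σ : K ≃ₐ[F] K) (C : Submodule K (Fin n → K)) (i : ℕ) :
    Sseq σ C (i + 1) =
      codeMap ((σ ^ (i + 1) : K ≃ₐ[F] K) : K ≃+* K) C ⊔ Sseq σ C i := by
  rw [Sseq, Finset.range_add_one, Finset.sup_insert, Sseq]

theorem codeMap_pow_le_Sseq (σ : K ≃ₐ[F] K) (C : Submodule K (Fin n → K)) {i j : ℕ}
    (h : j ≤ i) : codeMap ((σ ^ j : K ≃ₐ[F] K) : K ≃+* K) C ≤ Sseq σ C i :=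
  Finset.le_sup (f := fun j => codeMap ((σ ^ j : K ≃ₐ[F] K) : K ≃+* K) C)
    (Finset.mem_range.2 (Nat.lt_succ_of_le h))

theorem codeMap_Sseq_le (σ : K ≃ₐ[F] K) (C : Submodule K (Fin n → K)) (i : ℕ) :
    codeMap (σ : K ≃+* K) (Sseq σ C i) ≤ Sseq σ C (i + 1) := by
  refine Submodule.map_le_iff_le_comap.2 (Finset.sup_le fun j hj => ?_)
  refine Submodule.map_le_iff_le_comap.1 ((codeMap_codeMap_pow σ C j).trans_le ?_)
  exact codeMap_pow_le_Sseq σ C (Finset.mem_range.1 hj)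

theorem Sseq_succ_eq_of_eq {σ : K ≃ₐ[F] K} {C : Submodule K (Fin n → K)} {i : ℕ}
    (h : Sseq σ C (i + 1) = Sseq σ C i) : Sseq σ C (i + 2) = Sseq σ C (i + 1) := by
  rw [Sseq_succ, sup_eq_right, ← codeMap_codeMap_pow]
  have hle : codeMap ((σ ^ (i + 1) : K ≃ₐ[F] K) : K ≃+* K) C ≤ Sseq σ C i :=
    (codeMap_pow_le_Sseq σ C le_rfl).trans h.le
  exact (codeMap_mono _ hle).trans (codeMap_Sseq_le σ C i)

theorem Sseq_add_eq_of_eq {σ : K ≃ₐ[F] K} {C : Submodule K (Fin n → K)} {i : ℕ}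
    (h : Sseq σ C (i + 1) = Sseq σ C i) (j : ℕ) : Sseq σ C (i + j) = Sseq σ C i := by
  induction j generalizing i with
  | zero => rfl
  | succ j ih =>
    rw [← add_assoc, add_right_comm, ih (Sseq_succ_eq_of_eq h), h]

end StationarySums

/-- if `s_i^σ(C) = s_{i+1}^σ(C)` then `s_{i+j}^σ(C) = s_i^σ(C)`
for all `j ≥ 0`. -/
theorem sseq_stationary_forever
    {F K : Type} [Field F] [Field K] [Algebra F K] [Fintype F] [Fintype K]
    (m : ℕ) (hm : Module.finrank F K = m)
    (σ : K ≃ₐ[F] K) (hσ : ∀ τ : K ≃ₐ[F] K, τ ∈ Subgroup.zpowers σ)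
    (n : ℕ) (C : Submodule K (Fin n → K)) (i : ℕ)
    (h : sseq σ C i = sseq σ C (i + 1)) :
    ∀ j : ℕ, sseq σ C (i + j) = sseq σ C i := by
  have hS : Sseq σ C (i + 1) = Sseq σ C i :=
    (Submodule.eq_of_le_of_finrank_eq (Sseq_succ σ C i ▸ le_sup_right) h).symm
  exact fun j => congrArg (fun D : Submodule K (Fin n → K) => finrank K D)
    (Sseq_add_eq_of_eq hS j)
end

section
/- Let σ be a generator of Gal(F_{q^m}/F_q) and let C ⊆ F_{q^m}^n be an F_{q^m}-linear code of dimension k. Then s_{n-k+j}^σ(C) = s_{n-k}^σ(C) for all j ≥ 0. -/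
open Module

theorem mem_codeMap {K : Type} [Field K] {n : ℕ} {σ : K ≃+* K}
    {C : Submodule K (Fin n → K)} {w : Fin n → K} :
    w ∈ codeMap σ C ↔ ∃ v ∈ C, (fun x => σ (v x)) = w := Iff.rfl

theorem codeMap_sup {K : Type} [Field K] {n : ℕ} (σ : K ≃+* K)
    (C D : Submodule K (Fin n → K)) : codeMap σ (C ⊔ D) = codeMap σ C ⊔ codeMap σ D :=
  Submodule.map_sup C D (entrywiseMap n σ)

theorem codeMap_pow_succ {F K : Type} [Field F] [Field K] [Algebra F K] {n : ℕ}
    (σ : K ≃ₐ[F] K) (C : Submodule K (Fin n → K)) (i : ℕ) :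
    codeMap ((σ ^ (i + 1) : K ≃ₐ[F] K) : K ≃+* K) C =
      codeMap (σ : K ≃+* K) (codeMap ((σ ^ i : K ≃ₐ[F] K) : K ≃+* K) C) := by
  ext w
  simp [mem_codeMap, pow_succ']

theorem Sseq_zero {F K : Type} [Field F] [Field K] [Algebra F K] {n : ℕ}
    (σ : K ≃ₐ[F] K) (C : Submodule K (Fin n → K)) : Sseq σ C 0 = C := by
  ext w
  simp [Sseq, mem_codeMap]

theorem Sseq_succ_eq_Sseq_sup {F K : Type} [Field F] [Field K] [Algebra F K] {n : ℕ}
    (σ : K ≃ₐ[F] K) (C : Submodule K (Fin n → K)) (i : ℕ) :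
    Sseq σ C (i + 1) =
      Sseq σ C i ⊔ codeMap ((σ ^ (i + 1) : K ≃ₐ[F] K) : K ≃+* K) C := by
  rw [Sseq, Finset.range_add_one, Finset.sup_insert, sup_comm, Sseq]

theorem Sseq_succ_eq_sup_codeMap {F K : Type} [Field F] [Field K] [Algebra F K] {n : ℕ}
    (σ : K ≃ₐ[F] K) (C : Submodule K (Fin n → K)) (i : ℕ) :
    Sseq σ C (i + 1) = C ⊔ codeMap (σ : K ≃+* K) (Sseq σ C i) := by
  induction i with
  | zero => rw [Sseq_succ_eq_Sseq_sup, Sseq_zero, zero_add, pow_one]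
  | succ i ih =>
    rw [Sseq_succ_eq_Sseq_sup, codeMap_pow_succ, ih, sup_assoc, ← codeMap_sup,
      ← Sseq_succ_eq_Sseq_sup, ih]

theorem Sseq_le_succ {F K : Type} [Field F] [Field K] [Algebra F K] {n : ℕ}
    (σ : K ≃ₐ[F] K) (C : Submodule K (Fin n → K)) (i : ℕ) :
    Sseq σ C i ≤ Sseq σ C (i + 1) :=
  Sseq_succ_eq_Sseq_sup σ C i ▸ le_sup_left

theorem Sseq_add_eq_of_succ_eq {F K : Type} [Field F] [Field K] [Algebra F K] {n : ℕ}
    {σ : K ≃ₐ[F] K} {C : Submodule K (Fin n → K)} {i : ℕ}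
    (h : Sseq σ C (i + 1) = Sseq σ C i) (j : ℕ) : Sseq σ C (i + j) = Sseq σ C i := by
  induction j with
  | zero => rfl
  | succ j ih =>
    rw [← add_assoc, Sseq_succ_eq_sup_codeMap, ih, ← Sseq_succ_eq_sup_codeMap, h]

theorem Sseq_succ_eq_or_finrank_add_le {F K : Type} [Field F] [Field K] [Algebra F K] {n : ℕ}
    (σ : K ≃ₐ[F] K) (C : Submodule K (Fin n → K)) (i : ℕ) :
    Sseq σ C (i + 1) = Sseq σ C i ∨ Module.finrank K C + i ≤ sseq σ C i := by
  induction i with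
  | zero => exact .inr (by rw [sseq, Sseq_zero, add_zero])
  | succ i ih =>
    by_cases h : Sseq σ C (i + 1) = Sseq σ C i
    · exact .inl ((Sseq_add_eq_of_succ_eq h 2).trans h.symm)
    · have hlt : sseq σ C i < sseq σ C (i + 1) :=
        Submodule.finrank_lt_finrank_of_lt ((Sseq_le_succ σ C i).lt_of_ne' h)
      have hle := ih.resolve_left h
      exact .inr (by omega)

/-- `s_{n-k+j}^σ(C) = s_{n-k}^σ(C)` for all `j ≥ 0`, where
`k = dim C`. -/
theorem sseq_stationary_from_n_sub_k
    {F K : Type} [Field F] [Field K] [Algebra F K] [Fintype F] [Fintype K]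
    (m : ℕ) (hm : Module.finrank F K = m)
    (σ : K ≃ₐ[F] K) (hσ : ∀ τ : K ≃ₐ[F] K, τ ∈ Subgroup.zpowers σ)
    (n : ℕ) (C : Submodule K (Fin n → K))
    (k : ℕ) (hk : Module.finrank K C = k) :
    ∀ j : ℕ, sseq σ C (n - k + j) = sseq σ C (n - k) := by
  have hstable : Sseq σ C (n - k + 1) = Sseq σ C (n - k) := by
    refine (Sseq_succ_eq_or_finrank_add_le σ C (n - k)).elim id fun h => ?_
    have htop : Sseq σ C (n - k) = ⊤ := by
      apply Submodule.eq_top_of_finrank_eq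
      refine le_antisymm (Submodule.finrank_le _) ?_
      rw [Module.finrank_fin_fun]
      rw [sseq] at h
      omega
    exact le_antisymm (htop ▸ le_top) (Sseq_le_succ σ C (n - k))
  intro j
  rw [sseq, sseq, Sseq_add_eq_of_succ_eq hstable]
end

section
/- Let m = n and 1 < k < n−1. Consider the set of all Gabidulin codes G_k^τ(β) ⊆ F_{q^m}^m, where τ ranges over all generators of Gal(F_{q^m}/F_q) and β ranges over all vectors in F_{q^m}^m whose entries are linearly independent over F_q. Then the number of equivalence classes of this set under semilinear equivalence is exactly φ(m)/2, where φ denotes Euler's totient function. -/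
open Module

section GabidulinCount

/-- If a progression of length `k`, with `1 < k < m - 1`, in a cyclic group of order `m` is a
progression with respect to two generators, then these generators agree up to inversion. -/
theorem eq_or_eq_inv_of_progression_subset {G : Type*} [Group G] {m k : ℕ} (hk1 : 1 < k)
    (hk2 : k < m - 1) {g h t : G} (hh : ∀ x, x ∈ Subgroup.zpowers h) (hg : orderOf g = m)
    (ho : orderOf h = m) (ht : ∀ j < k, ∃ i < k, g ^ j * t = h ^ i) :
    g = h ∨ g = h⁻¹ := by
  classical
  have hinj : ∀ a < m, ∀ b < m, h ^ a = h ^ b → a = b := fun a ha b hb hab =>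
    pow_injOn_Iio_orderOf (by simpa [ho] using ha) (by simpa [ho] using hb) hab
  have hinjg : ∀ a < m, ∀ b < m, g ^ a = g ^ b → a = b := fun a ha b hb hab =>
    pow_injOn_Iio_orderOf (by simpa [hg] using ha) (by simpa [hg] using hb) hab
  have hsub : (Finset.range k).image (fun j => g ^ j * t) ⊆
      (Finset.range k).image (fun i => h ^ i) := by
    intro x hx
    simp only [Finset.mem_image, Finset.mem_range] at hx ⊢
    obtain ⟨j, hj, rfl⟩ := hx
    obtain ⟨i, hi, hij⟩ := ht j hj
    exact ⟨i, hi, hij.symm⟩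
  have heq := Finset.eq_of_subset_of_card_le hsub (by
    refine Finset.card_image_le.trans ?_
    rw [Finset.card_image_of_injOn]
    intro a ha b hb hab
    simp only [Finset.coe_range, Set.mem_Iio] at ha hb
    exact hinjg a (by omega) b (by omega) (mul_right_cancel hab))
  have hrev : ∀ i < k, ∃ j < k, g ^ j * t = h ^ i := by
    intro i hi
    have : h ^ i ∈ (Finset.range k).image (fun j => g ^ j * t) := by
      rw [heq]
      exact Finset.mem_image_of_mem _ (Finset.mem_range.2 hi)
    simpa using this
  obtain ⟨u, hu, hgu⟩ : ∃ u < m, h ^ u = g := by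
    have hfin : IsOfFinOrder h := orderOf_pos_iff.1 (by omega)
    have hmem := hfin.mem_zpowers_iff_mem_range_orderOf.1 (hh g)
    simpa [ho] using hmem
  have hexit : ∀ i < k, ∀ w, k ≤ w → w < m → g * h ^ i = h ^ w → h ^ i = g ^ (k - 1) * t := by
    intro i hi w hkw hwm hw
    obtain ⟨j, hj, hij⟩ := hrev i hi
    by_cases hjk : j + 1 < k
    · obtain ⟨i', hi', h'⟩ := ht (j + 1) hjk
      rw [pow_succ', mul_assoc, hij, hw] at h'
      have := hinj _ hwm _ (by omega) h'
      omega
    · rw [← hij]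
      congr 2
      omega
  have hunique : ∀ i < k, ∀ i' < k, ∀ w w', k ≤ w → w < m → k ≤ w' → w' < m →
      g * h ^ i = h ^ w → g * h ^ i' = h ^ w' → i = i' := by
    intro i hi i' hi' w w' h1 h2 h3 h4 h5 h6
    exact hinj _ (by omega) _ (by omega)
      ((hexit i hi w h1 h2 h5).trans (hexit i' hi' w' h3 h4 h6).symm)
  have hmul : ∀ i w, u + i = w → g * h ^ i = h ^ w := by
    rintro i w rfl
    rw [pow_add, hgu]
  have hu0 : u ≠ 0 := by
    rintro rfl
    rw [← hgu, pow_zero, orderOf_one] at hg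
    omega
  by_cases h1 : u = 1
  · left
    rw [← hgu, h1, pow_one]
  by_cases h2 : u = m - 1
  · right
    rw [eq_inv_iff_mul_eq_one, ← hgu, ← pow_succ, h2, show m - 1 + 1 = m by omega, ← ho,
      pow_orderOf_eq_one]
  exfalso
  rcases le_or_gt u (m - k) with hle | hlt
  · have := hunique (k - 1) (by omega) (k - 2) (by omega) (u + (k - 1)) (u + (k - 2))
      (by omega) (by omega) (by omega) (by omega) (hmul _ _ rfl) (hmul _ _ rfl)
    omega
  · have := hunique (m - 1 - u) (by omega) (m - 2 - u) (by omega) (m - 1) (m - 2)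
      (by omega) (by omega) (by omega) (by omega) (hmul _ _ (by omega)) (hmul _ _ (by omega))
    omega

/-- In a cyclic group of order `m > 2`, one can choose one generator out of each pair of mutually
inverse generators. -/
theorem exists_finset_generators_mod_inv {G : Type*} [Group G] [Finite G] [IsCyclic G] {m : ℕ}
    (hm : Nat.card G = m) (hm2 : 2 < m) :
    ∃ R : Finset G, R.card = Nat.totient m / 2 ∧ (∀ g ∈ R, orderOf g = m) ∧
      (∀ g, orderOf g = m → g ∈ R ∨ g⁻¹ ∈ R) ∧ ∀ g ∈ R, g⁻¹ ∉ R := by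
  classical
  have := Fintype.ofFinite G
  let e := Fintype.equivFin G
  let A : Finset G := Finset.univ.filter fun g => orderOf g = m
  have hA : A.card = Nat.totient m :=
    IsCyclic.card_orderOf_eq_totient (by rw [← Nat.card_eq_fintype_card, hm])
  have hne : ∀ g : G, orderOf g = m → e g ≠ e g⁻¹ := by
    intro g hg he
    have h1 : g ^ 2 = 1 := by
      rw [pow_two]
      exact eq_inv_iff_mul_eq_one.1 (e.injective he)
    have := Nat.le_of_dvd two_pos (orderOf_dvd_of_pow_eq_one h1)
    omega
  refine ⟨A.filter fun g => e g < e g⁻¹, ?_, ?_, ?_, ?_⟩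
  · have hsum := Finset.card_filter_add_card_filter_not (s := A) (fun g => e g < e g⁻¹)
    have himg : (A.filter fun g => ¬ e g < e g⁻¹) =
        (A.filter fun g => e g < e g⁻¹).image (fun g => g⁻¹) := by
      ext g
      simp only [Finset.mem_filter, Finset.mem_image, A, Finset.mem_univ, true_and]
      constructor
      · rintro ⟨hg, hlt⟩
        refine ⟨g⁻¹, ⟨by simpa using hg, ?_⟩, inv_inv g⟩
        rw [inv_inv]
        exact lt_of_le_of_ne (not_lt.1 hlt) (hne g hg).symm
      · rintro ⟨x, ⟨hx, hlt⟩, rfl⟩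
        refine ⟨by simpa using hx, ?_⟩
        rw [inv_inv]
        exact not_lt.2 hlt.le
    rw [himg, Finset.card_image_of_injective _ inv_injective, hA] at hsum
    omega
  · intro g hg
    simp only [Finset.mem_filter, A, Finset.mem_univ, true_and] at hg
    exact hg.1
  · intro g hg
    simp only [Finset.mem_filter, A, Finset.mem_univ, true_and, orderOf_inv, hg, inv_inv]
    exact lt_or_gt_of_ne (hne g hg)
  · intro g hg hg'
    simp only [Finset.mem_filter, inv_inv] at hg hg'
    exact lt_asymm hg.2 hg'.2

theorem FiniteField.exists_ringEquiv_eq_pow {K : Type*} [Field K] [Finite K] (θ : K ≃+* K) :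
    ∃ a : ℤ, ∀ x, x ≠ 0 → θ x = x ^ a := by
  obtain ⟨a, ha⟩ := MonoidHom.map_cyclic (Units.map (θ : K →* K))
  refine ⟨a, fun x hx => ?_⟩
  simpa using congrArg Units.val (ha (Units.mk0 x hx))

theorem FiniteField.ringEquiv_comm {K : Type*} [Field K] [Finite K] (θ τ : K ≃+* K) (x : K) :
    θ (τ x) = τ (θ x) := by
  obtain ⟨a, ha⟩ := exists_ringEquiv_eq_pow θ
  rcases eq_or_ne x 0 with rfl | hx
  · simp
  · rw [ha x hx, ha (τ x) (by simpa using hx), map_zpow₀]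

variable {F K : Type} [Field F] [Field K] [Algebra F K]

/-- The Moore matrix of an `F`-basis of `K` has independent rows. -/
theorem linearIndependent_algEquiv_basis [FiniteDimensional F K] {n : ℕ} (b : Basis (Fin n) F K) :
    LinearIndependent K (fun (g : K ≃ₐ[F] K) (x : Fin n) => g (b x)) := by
  have h := ((linearIndependent_algHom_toLinearMap F K K).comp _
    (algEquivEquivAlgHom F K).injective).map' _ (b.constr K).symm.ker
  exact h

theorem exists_coeff_of_mem_Gab [FiniteDimensional F K] {n k : ℕ} {τ : K ≃ₐ[F] K}
    {β v : Fin n → K} (hv : v ∈ Gab τ k β) :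
    ∃ c : (K ≃ₐ[F] K) → K, (∀ g, c g ≠ 0 → ∃ i < k, g = τ ^ i) ∧
      v = ∑ g, c g • fun x => g (β x) := by
  classical
  induction hv using Submodule.span_induction with
  | mem v hv =>
    obtain ⟨j, hj, rfl⟩ := hv
    refine ⟨Pi.single (τ ^ j) 1, fun g hg => ⟨j, hj, ?_⟩, ?_⟩
    · by_contra hne
      exact hg (Pi.single_eq_of_ne hne _)
    · rw [Finset.sum_eq_single (τ ^ j)]
      · simp
      · intro g _ hg
        simp [Pi.single_eq_of_ne hg]
      · simp
  | zero => exact ⟨0, by simp, by simp⟩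
  | add v w _ _ hv hw =>
    obtain ⟨c, hc, rfl⟩ := hv
    obtain ⟨d, hd, rfl⟩ := hw
    refine ⟨c + d, fun g hg => ?_, by simp [add_smul, Finset.sum_add_distrib]⟩
    by_cases h : c g = 0
    · exact hd g (by simpa [h] using hg)
    · exact hc g h
  | smul a v _ hv =>
    obtain ⟨c, hc, rfl⟩ := hv
    refine ⟨a • c, fun g hg => hc g fun h => hg (by simp [h]), ?_⟩
    simp [Finset.smul_sum, mul_smul]

theorem mem_Gab {n k j : ℕ} (hj : j < k) (τ : K ≃ₐ[F] K) (β : Fin n → K) :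
    (fun x => (τ ^ j) (β x)) ∈ Gab τ k β :=
  Submodule.subset_span ⟨j, hj, rfl⟩

/-- A Gabidulin code of full length determines its generator up to inversion. -/
theorem eq_or_eq_inv_of_Gab_eq [FiniteDimensional F K] {m k : ℕ} (hm : finrank F K = m)
    (hk1 : 1 < k) (hk2 : k < m - 1) {σ τ : K ≃ₐ[F] K}
    (hτ : ∀ ρ, ρ ∈ Subgroup.zpowers τ) (hoσ : orderOf σ = m) (hoτ : orderOf τ = m)
    {β γ : Fin m → K} (hβ : LinearIndependent F β) (h : Gab σ k γ = Gab τ k β) :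
    σ = τ ∨ σ = τ⁻¹ := by
  have : NeZero m := ⟨by omega⟩
  let b : Basis (Fin m) F K := basisOfLinearIndependentOfCardEqFinrank hβ (by simp [hm])
  have hb : ⇑b = β := coe_basisOfLinearIndependentOfCardEqFinrank _ _
  have hli := linearIndependent_algEquiv_basis b
  rw [hb] at hli
  have hγ : γ ≠ 0 := by
    rintro rfl
    have hbot : Gab σ k (0 : Fin m → K) = ⊥ := by
      rw [Gab, Submodule.span_eq_bot]
      rintro v ⟨j, -, rfl⟩
      funext x
      simp
    have hmem := mem_Gab (show 0 < k by omega) τ β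
    rw [← h, hbot, Submodule.mem_bot] at hmem
    exact hβ.ne_zero 0 (by simpa using congrFun hmem 0)
  have hmem : ∀ j < k, (fun x => (σ ^ j) (γ x)) ∈ Gab τ k β := fun j hj => h ▸ mem_Gab hj σ γ
  obtain ⟨c, -, hc⟩ := exists_coeff_of_mem_Gab (by simpa using hmem 0 (by omega))
  change γ = _ at hc
  obtain ⟨t, ht⟩ : ∃ t, c t ≠ 0 := by
    by_contra! h0
    exact hγ (by rw [hc]; simp [h0])
  refine eq_or_eq_inv_of_progression_subset (t := t) hk1 hk2 hτ hoσ hoτ fun j hj => ?_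
  obtain ⟨d, hd, hdj⟩ := exists_coeff_of_mem_Gab (hmem j hj)
  refine hd _ ?_
  have hshift : (fun x => (σ ^ j) (γ x)) =
      ∑ g, (σ ^ j) (c ((σ ^ j)⁻¹ * g)) • fun x => g (β x) := by
    rw [← Equiv.sum_comp (Equiv.mulLeft (σ ^ j))]
    funext x
    rw [hc]
    simp
  have hcoeff := Fintype.linearIndependent_iff.1 hli
    (fun g => d g - (σ ^ j) (c ((σ ^ j)⁻¹ * g))) (by
      simp only [sub_smul, Finset.sum_sub_distrib]
      rw [← hdj, ← hshift, sub_self]) (σ ^ j * t)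
  rw [inv_mul_cancel_left, sub_eq_zero] at hcoeff
  rw [hcoeff]
  exact (map_ne_zero_iff _ (σ ^ j).injective).2 ht

theorem image_vecMul_Gab [Finite K] {n k : ℕ} (θ : K ≃+* K) (τ : K ≃ₐ[F] K) (β : Fin n → K)
    {A : Matrix (Fin n) (Fin n) K} (hA : ∀ i j, A i j ∈ Set.range (algebraMap F K)) :
    (fun v => Matrix.vecMul (fun j => θ (v j)) A) '' (Gab τ k β : Set (Fin n → K)) =
      Gab τ k (Matrix.vecMul (fun j => θ (β j)) A) := by
  let f := (Matrix.vecMulLinear A).comp (entrywiseMap n θ)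
  have hgen : ∀ j, f (fun x => (τ ^ j) (β x)) =
      fun x => (τ ^ j) (Matrix.vecMul (fun j => θ (β j)) A x) := by
    intro j
    funext x
    change Matrix.vecMul (fun i => θ ((τ ^ j) (β i))) A x = _
    simp only [Matrix.vecMul, dotProduct, map_sum, map_mul]
    refine Finset.sum_congr rfl fun i _ => ?_
    obtain ⟨a, ha⟩ := hA i x
    rw [← ha, AlgEquiv.commutes]
    congr 1
    exact FiniteField.ringEquiv_comm θ ((τ ^ j : K ≃ₐ[F] K) : K ≃+* K) (β i)
  change (f '' _) = _
  rw [← Submodule.map_coe, Gab, Submodule.map_span, Gab]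
  congr 2
  ext v
  constructor
  · rintro ⟨_, ⟨j, hj, rfl⟩, rfl⟩
    exact ⟨j, hj, hgen j⟩
  · rintro ⟨j, hj, rfl⟩
    exact ⟨_, ⟨j, hj, rfl⟩, hgen j⟩

/-- Full-length Gabidulin codes with respect to the same generator are equivalent. -/
theorem semilinEquiv_Gab [Finite K] {m : ℕ} (hm : finrank F K = m) (k : ℕ) (hm0 : m ≠ 0)
    (τ : K ≃ₐ[F] K) {β γ : Fin m → K} (hβ : LinearIndependent F β)
    (hγ : LinearIndependent F γ) : SemilinEquiv F (Gab τ k β) (Gab τ k γ) := by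
  have : NeZero m := ⟨hm0⟩
  let b : Basis (Fin m) F K := basisOfLinearIndependentOfCardEqFinrank hβ (by simp [hm])
  let c : Basis (Fin m) F K := basisOfLinearIndependentOfCardEqFinrank hγ (by simp [hm])
  have hb : ⇑b = β := coe_basisOfLinearIndependentOfCardEqFinrank _ _
  have hc : ⇑c = γ := coe_basisOfLinearIndependentOfCardEqFinrank _ _
  have hA : ∀ i j, (b.toMatrix c).map (algebraMap F K) i j ∈ Set.range (algebraMap F K) :=
    fun i j => ⟨_, rfl⟩
  refine ⟨RingEquiv.refl K, (b.toMatrix c).map (algebraMap F K), hA, ?_, ?_⟩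
  · exact (IsUnit.of_mul_eq_one _ (b.toMatrix_mul_toMatrix_flip c)).map
      (algebraMap F K).mapMatrix
  · rw [image_vecMul_Gab _ _ _ hA]
    congr 2
    funext j
    have := b.sum_toMatrix_smul_self c j
    rw [hb, hc] at this
    simp [Matrix.vecMul, dotProduct, ← this, Algebra.smul_def, mul_comm, hc]

theorem Gab_inv {n k : ℕ} (τ : K ≃ₐ[F] K) (β : Fin n → K) :
    Gab τ k β = Gab τ⁻¹ k (fun x => (τ ^ (k - 1)) (β x)) := by
  have hcancel : ∀ i j l, i + j = l → ∀ y : K, (τ⁻¹ ^ i) ((τ ^ l) y) = (τ ^ j) y := by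
    rintro i j _ rfl y
    rw [← AlgEquiv.mul_apply, pow_add, inv_pow, inv_mul_cancel_left]
  unfold Gab
  congr 1
  ext v
  constructor
  · rintro ⟨j, hj, rfl⟩
    exact ⟨k - 1 - j, by omega, funext fun x => (hcancel _ _ _ (by omega) _).symm⟩
  · rintro ⟨j, hj, rfl⟩
    exact ⟨k - 1 - j, by omega, funext fun x => hcancel _ _ _ (by omega) _⟩

end GabidulinCount

/-- for `m = n` and `1 < k < m−1`, the set of all Gabidulin codes
`G_k^τ(β) ⊆ K^m` (with `τ` a generator of the Galois group and `β` a vector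
with `F`-linearly independent entries) has exactly `φ(m)/2` equivalence classes
under semilinear equivalence. -/
theorem number_of_inequivalent_gabidulin_codes
    {F K : Type} [Field F] [Field K] [Algebra F K] [Fintype F] [Fintype K]
    (m : ℕ) (hm : Module.finrank F K = m)
    (k : ℕ) (hk1 : 1 < k) (hk2 : k < m - 1) :
    ∃ S : Finset (Submodule K (Fin m → K)),
      S.card = Nat.totient m / 2 ∧
      (∀ C ∈ S, ∃ (τ : K ≃ₐ[F] K) (β : Fin m → K),
        (∀ ρ : K ≃ₐ[F] K, ρ ∈ Subgroup.zpowers τ) ∧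
        LinearIndependent F β ∧ C = Gab τ k β) ∧
      (∀ (τ : K ≃ₐ[F] K) (β : Fin m → K),
        (∀ ρ : K ≃ₐ[F] K, ρ ∈ Subgroup.zpowers τ) → LinearIndependent F β →
        ∃ C ∈ S, SemilinEquiv F (Gab τ k β) C) ∧
      (∀ C ∈ S, ∀ C' ∈ S, SemilinEquiv F C C' → C = C') := by
  classical
  have hcard : Nat.card (K ≃ₐ[F] K) = m := (IsGalois.card_aut_eq_finrank F K).trans hm
  have hord : ∀ τ : K ≃ₐ[F] K, (∀ ρ, ρ ∈ Subgroup.zpowers τ) ↔ orderOf τ = m := fun τ => by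
    rw [← hcard]
    refine ⟨orderOf_eq_card_of_forall_mem_zpowers, fun h ρ => ?_⟩
    rw [Subgroup.eq_top_of_card_eq (Subgroup.zpowers τ) (by rw [Nat.card_zpowers, h])]
    trivial
  obtain ⟨R, hRcard, hRord, hRmem, hRinv⟩ := exists_finset_generators_mod_inv hcard (by omega)
  let b : Basis (Fin m) F K := finBasisOfFinrankEq F K hm
  have hb : LinearIndependent F b := b.linearIndependent
  have hR : ∀ σ ∈ R, ∀ τ ∈ R, ∀ γ, Gab σ k γ = Gab τ k b → σ = τ := by
    intro σ hσ τ hτ γ h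
    rcases eq_or_eq_inv_of_Gab_eq hm hk1 hk2 ((hord τ).2 (hRord τ hτ)) (hRord σ hσ)
      (hRord τ hτ) hb h with h | rfl
    · exact h
    · exact absurd hσ (hRinv τ hτ)
  refine ⟨R.image fun τ => Gab τ k b, ?_, ?_, ?_, ?_⟩
  · rw [Finset.card_image_of_injOn, hRcard]
    exact fun σ hσ τ hτ h => hR σ hσ τ hτ b h
  · intro C hC
    obtain ⟨τ, hτ, rfl⟩ := Finset.mem_image.1 hC
    exact ⟨τ, b, (hord τ).2 (hRord τ hτ), hb, rfl⟩
  · intro τ β hτ hβ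
    rcases hRmem τ ((hord τ).1 hτ) with h | h
    · exact ⟨_, Finset.mem_image_of_mem _ h, semilinEquiv_Gab hm k (by omega) τ hβ hb⟩
    · refine ⟨_, Finset.mem_image_of_mem _ h, ?_⟩
      rw [Gab_inv]
      exact semilinEquiv_Gab hm k (by omega) τ⁻¹
        (hβ.map' (τ ^ (k - 1)).toLinearMap (LinearMap.ker_eq_bot.2 (τ ^ (k - 1)).injective)) hb
  · intro C hC C' hC' hCC'
    obtain ⟨σ, hσ, rfl⟩ := Finset.mem_image.1 hC
    obtain ⟨τ, hτ, rfl⟩ := Finset.mem_image.1 hC'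
    obtain ⟨θ, A, hA, -, h⟩ := hCC'
    rw [image_vecMul_Gab θ σ b hA] at h
    rw [hR σ hσ τ hτ _ (SetLike.coe_injective h).symm]
end

section
/- Let C = H_{k,η}^σ(α) be a Sheekey twisted Gabidulin code with 2 ≤ k ≤ n−1, η ≠ 0, and N(η) ≠ (−1)^{km}. Then for all integers 1 ≤ ℓ ≤ k−1 and i ≥ 1, S_i^{σ^ℓ}(C) equals the F_{q^m}-span of {α, σ(α), …, σ^{k+iℓ}(α)}, and s_i^{σ^ℓ}(C) = min{k+iℓ+1, n}. -/
open Module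

section GabidulinDimension

variable {F K : Type} [Field F] [Field K] [Algebra F K] {n : ℕ}

theorem entrywiseMap_pow_apply (σ : K ≃ₐ[F] K) (j : ℕ) (α : Fin n → K) :
    entrywiseMap n (σ : K ≃+* K) (fun x => (σ ^ j) (α x)) = fun x => (σ ^ (j + 1)) (α x) := by
  funext x
  rw [pow_succ']
  rfl

theorem pow_apply_mem_Gab (σ : K ≃ₐ[F] K) {j k : ℕ} (hj : j < k) (α : Fin n → K) :
    (fun x => (σ ^ j) (α x)) ∈ Gab σ k α :=
  Submodule.subset_span ⟨j, hj, rfl⟩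

theorem Gab_le_iff (σ : K ≃ₐ[F] K) (k : ℕ) (α : Fin n → K) (V : Submodule K (Fin n → K)) :
    Gab σ k α ≤ V ↔ ∀ j < k, (fun x => (σ ^ j) (α x)) ∈ V := by
  rw [Gab, Submodule.span_le]
  constructor
  · exact fun h j hj => h ⟨j, hj, rfl⟩
  · rintro h _ ⟨j, hj, rfl⟩
    exact h j hj

theorem Gab_mono (σ : K ≃ₐ[F] K) (α : Fin n → K) {k l : ℕ} (h : k ≤ l) :
    Gab σ k α ≤ Gab σ l α :=
  (Gab_le_iff _ _ _ _).2 fun _ hj => pow_apply_mem_Gab σ (hj.trans_le h) α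

theorem codeMap_Gab_le (σ : K ≃ₐ[F] K) (k : ℕ) (α : Fin n → K) :
    codeMap (σ : K ≃+* K) (Gab σ k α) ≤ Gab σ (k + 1) α := by
  rw [codeMap, Gab, Submodule.map_span, Submodule.span_le]
  rintro _ ⟨_, ⟨j, hj, rfl⟩, rfl⟩
  exact Submodule.subset_span ⟨j + 1, by lia, entrywiseMap_pow_apply σ j α⟩

/-- The conjugates of a vector with linearly independent entries span the whole space. -/
theorem eq_top_of_forall_conjugate_mem [FiniteDimensional F K] [IsGalois F K] {α : Fin n → K}
    (hα : LinearIndependent F α) (V : Submodule K (Fin n → K))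
    (hV : ∀ τ : K ≃ₐ[F] K, (fun x => τ (α x)) ∈ V) : V = ⊤ := by
  by_contra hne
  obtain ⟨f, hf, hVf⟩ := Submodule.exists_le_ker_of_lt_top V (lt_top_iff_ne_top.2 hne)
  have hsum (τ : K ≃ₐ[F] K) (c : K) :
      ∑ x, τ (c * f (Pi.single x 1)) * α x = 0 := by
    have h := hVf (hV τ⁻¹)
    rw [LinearMap.mem_ker, LinearMap.pi_apply_eq_sum_univ] at h
    have h' := congrArg (fun y => τ (c * y)) h
    simp only [mul_zero, map_zero, Finset.mul_sum, map_sum, smul_eq_mul] at h'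
    rw [← h']
    refine Finset.sum_congr rfl fun x _ => ?_
    have hx : τ (τ⁻¹ (α x)) = α x := by
      rw [← AlgEquiv.mul_apply, mul_inv_cancel, AlgEquiv.one_apply]
    have hs : (fun j => if x = j then (1 : K) else 0) = Pi.single x 1 := by
      funext j
      simp [Pi.single_apply, eq_comm]
    rw [hs, map_mul, map_mul, map_mul, hx]
    ring
  have htrace (c : K) (x : Fin n) : Algebra.trace F K (c * f (Pi.single x 1)) = 0 := by
    refine Fintype.linearIndependent_iff.1 hα
      (fun x => Algebra.trace F K (c * f (Pi.single x 1))) ?_ x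
    simp only [Algebra.smul_def, trace_eq_sum_automorphisms, Finset.sum_mul]
    rw [Finset.sum_comm]
    exact Finset.sum_eq_zero fun τ _ => hsum τ c
  have hzero (x : Fin n) : f (Pi.single x 1) = 0 :=
    (traceForm_nondegenerate F K).2 _ fun c => by
      simpa [Algebra.traceForm_apply] using htrace c x
  apply hf
  refine LinearMap.pi_ext' fun x => LinearMap.ext_ring ?_
  simpa using hzero x

theorem Gab_eq_top_of_succ_le [Finite F] [Finite K] {σ : K ≃ₐ[F] K}
    (hσ : ∀ τ : K ≃ₐ[F] K, τ ∈ Subgroup.zpowers σ) {α : Fin n → K}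
    (hα : LinearIndependent F α) {r : ℕ} (h : Gab σ (r + 1) α ≤ Gab σ r α) :
    Gab σ r α = ⊤ := by
  have hpow (j : ℕ) : (fun x => (σ ^ j) (α x)) ∈ Gab σ r α := by
    induction j with
    | zero => exact h (pow_apply_mem_Gab σ r.succ_pos α)
    | succ j ih =>
      rw [← entrywiseMap_pow_apply]
      exact h (codeMap_Gab_le σ r α (Submodule.mem_map_of_mem ih))
  refine eq_top_of_forall_conjugate_mem hα _ fun τ => ?_
  obtain ⟨j, rfl⟩ := mem_powers_iff_mem_zpowers.2 (hσ τ)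
  exact hpow j

theorem finrank_Gab [Finite F] [Finite K] {σ : K ≃ₐ[F] K}
    (hσ : ∀ τ : K ≃ₐ[F] K, τ ∈ Subgroup.zpowers σ) {α : Fin n → K}
    (hα : LinearIndependent F α) (r : ℕ) : finrank K (Gab σ r α) = min r n := by
  refine le_antisymm (le_min ?_ ?_) ?_
  · have hrange : Gab σ r α =
        Submodule.span K (Set.range fun (j : Fin r) x => (σ ^ (j : ℕ)) (α x)) := by
      rw [Gab]
      congr 1
      ext v
      constructor
      · rintro ⟨j, hj, rfl⟩
        exact ⟨⟨j, hj⟩, rfl⟩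
      · rintro ⟨j, rfl⟩
        exact ⟨j, j.2, rfl⟩
    rw [hrange]
    simpa [Set.finrank] using
      finrank_range_le_card (R := K) (fun (j : Fin r) x => (σ ^ (j : ℕ)) (α x))
  · simpa using Submodule.finrank_le (Gab σ r α)
  · induction r with
    | zero => simp
    | succ r ih =>
      by_cases h : Gab σ (r + 1) α ≤ Gab σ r α
      · rw [h.antisymm (Gab_mono σ α (Nat.le_add_right r 1)), Gab_eq_top_of_succ_le hσ hα h]
        simp
      · have := Submodule.finrank_lt_finrank_of_lt
          (lt_of_le_not_ge (Gab_mono σ α (Nat.le_add_right r 1)) h)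
        lia

end GabidulinDimension

section TwistedGabidulin

variable {F K : Type} [Field F] [Field K] [Algebra F K] {n : ℕ}

theorem codeMap_pow_TGab (σ : K ≃ₐ[F] K) (k s : ℕ) (η : K) (α : Fin n → K) :
    codeMap ((σ ^ s : K ≃ₐ[F] K) : K ≃+* K) (TGab σ k η α) =
      Submodule.span K
        (insert (fun x => (σ ^ s) (α x) + (σ ^ s) η * (σ ^ (s + k)) (α x))
          {v | ∃ j, 1 ≤ j ∧ j < k ∧ v = fun x => (σ ^ (s + j)) (α x)}) := by
  rw [codeMap, TGab, Submodule.map_span, Set.image_insert_eq]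
  congr 2
  · funext x
    change (σ ^ s) (α x + η * (σ ^ k) (α x)) = _
    rw [map_add, map_mul, pow_add, AlgEquiv.mul_apply]
  · ext v
    constructor
    · rintro ⟨_, ⟨j, h1, h2, rfl⟩, rfl⟩
      refine ⟨j, h1, h2, ?_⟩
      funext x
      rw [pow_add]
      rfl
    · rintro ⟨j, h1, h2, rfl⟩
      refine ⟨_, ⟨j, h1, h2, rfl⟩, ?_⟩
      funext x
      rw [pow_add]
      rfl

theorem Sseq_pow_TGab (σ : K ≃ₐ[F] K) {k : ℕ} {η : K} (hη : η ≠ 0) (α : Fin n → K)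
    {ℓ : ℕ} (hℓ : 1 ≤ ℓ) (hℓk : ℓ < k) {i : ℕ} (hi : 1 ≤ i) :
    Sseq (σ ^ ℓ) (TGab σ k η α) i = Gab σ (k + i * ℓ + 1) α := by
  apply le_antisymm
  · refine Finset.sup_le fun t ht => ?_
    have hti : t * ℓ ≤ i * ℓ := Nat.mul_le_mul_right _ (by simpa [Nat.lt_succ_iff] using ht)
    rw [← pow_mul, mul_comm ℓ t, codeMap_pow_TGab, Submodule.span_le]
    rintro _ (rfl | ⟨j, h1, h2, rfl⟩)
    · exact Submodule.add_mem _ (pow_apply_mem_Gab σ (by lia) α)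
        (Submodule.smul_mem _ ((σ ^ (t * ℓ)) η) (pow_apply_mem_Gab σ (by lia) α))
    · exact pow_apply_mem_Gab σ (by lia) α
  · set S := Sseq (σ ^ ℓ) (TGab σ k η α) i
    have hS {t : ℕ} (ht : t ≤ i) : Submodule.span K
        (insert (fun x => (σ ^ (t * ℓ)) (α x) + (σ ^ (t * ℓ)) η * (σ ^ (t * ℓ + k)) (α x))
          {v | ∃ j, 1 ≤ j ∧ j < k ∧ v = fun x => (σ ^ (t * ℓ + j)) (α x)}) ≤ S := by
      rw [← codeMap_pow_TGab, mul_comm t ℓ, pow_mul]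
      exact Finset.le_sup (f := fun j => codeMap (((σ ^ ℓ) ^ j : K ≃ₐ[F] K) : K ≃+* K)
        (TGab σ k η α)) (Finset.mem_range.2 (Nat.lt_succ_of_le ht))
    have htwist {t : ℕ} (ht : t ≤ i) :
        (fun x => (σ ^ (t * ℓ)) (α x) + (σ ^ (t * ℓ)) η * (σ ^ (t * ℓ + k)) (α x)) ∈ S :=
      hS ht (Submodule.subset_span (Set.mem_insert _ _))
    have hinner {t : ℕ} (ht : t ≤ i) {j : ℕ} (h1 : t * ℓ < j) (h2 : j < t * ℓ + k) :
        (fun x => (σ ^ j) (α x)) ∈ S := by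
      obtain ⟨d, rfl⟩ := Nat.exists_eq_add_of_lt h1
      exact hS ht (Submodule.subset_span (Set.mem_insert_of_mem _
        ⟨d + 1, by lia, by lia, rfl⟩))
    have hmid {t : ℕ} (ht : t ≤ i) {j : ℕ} (h1 : 1 ≤ j) (h2 : j < t * ℓ + k) :
        (fun x => (σ ^ j) (α x)) ∈ S := by
      induction t with
      | zero => exact hinner ht (by lia) h2
      | succ t ih =>
        rw [add_mul, one_mul] at h2
        by_cases h : j < t * ℓ + k
        · exact ih (by lia) h
        · exact hinner ht (by rw [add_mul, one_mul]; lia) (by rw [add_mul, one_mul]; exact h2)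
    have hiℓ : ℓ ≤ i * ℓ := Nat.le_mul_of_pos_left _ hi
    rw [Gab_le_iff]
    intro j hj
    rcases Nat.eq_zero_or_pos j with rfl | hpos
    · have h0 := Submodule.sub_mem _ (htwist (Nat.zero_le i))
        (Submodule.smul_mem _ η (hmid le_rfl (j := k) (by lia) (by lia)))
      convert h0 using 1
      funext x
      simp
    · rcases Nat.lt_or_ge j (i * ℓ + k) with hlt | hge
      · exact hmid le_rfl hpos hlt
      · obtain rfl : j = i * ℓ + k := by lia
        have hη' : (σ ^ (i * ℓ)) η ≠ 0 :=
          (map_ne_zero (σ ^ (i * ℓ))).2 hη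
        have hlast := Submodule.sub_mem _ (htwist le_rfl)
          (hmid le_rfl (j := i * ℓ) (by lia) (by lia))
        rw [← Submodule.smul_mem_iff _ hη']
        convert hlast using 1
        funext x
        simp

end TwistedGabidulin

/-- for a Sheekey twisted Gabidulin code `C = H_{k,η}^σ(α)` with
`N(η) ≠ (−1)^{km}` and `1 ≤ ℓ ≤ k−1`, `i ≥ 1`, one has
`S_i^{σ^ℓ}(C) = G_{k+iℓ+1}^σ(α)` and `s_i^{σ^ℓ}(C) = min{k+iℓ+1, n}`. -/
theorem sheekey_sseq_small_power
    {F K : Type} [Field F] [Field K] [Algebra F K] [Fintype F] [Fintype K]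
    (m : ℕ) (hm : Module.finrank F K = m)
    (σ : K ≃ₐ[F] K) (hσ : ∀ τ : K ≃ₐ[F] K, τ ∈ Subgroup.zpowers σ)
    (n k : ℕ) (hk1 : 2 ≤ k) (hkn : k + 1 ≤ n) (hnm : n ≤ m)
    (α : Fin n → K) (hα : LinearIndependent F α)
    (η : K) (hη : η ≠ 0) (hN : Algebra.norm F η ≠ (-1 : F) ^ (k * m))
    (C : Submodule K (Fin n → K)) (hC : C = TGab σ k η α)
    (ℓ : ℕ) (hℓ1 : 1 ≤ ℓ) (hℓ2 : ℓ ≤ k - 1) (i : ℕ) (hi : 1 ≤ i) :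
    Sseq (σ ^ ℓ) C i = Gab σ (k + i * ℓ + 1) α ∧
    sseq (σ ^ ℓ) C i = min (k + i * ℓ + 1) n := by
  subst hC
  have hS := Sseq_pow_TGab σ hη α hℓ1 (show ℓ < k by lia) hi
  exact ⟨hS, by rw [sseq, hS, finrank_Gab hσ hα]⟩
end
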